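/- Let p, q ≥ 1 and l, m, b be natural numbers, D a real m×l matrix, T a real b×l matrix, and let M_p (m×m) and M_q (l×l) be symmetric real matrices. Suppose e_p : ℝ → ℝ^m and e_q : ℝ → ℝ^l are differentiable curves and f_b : ℝ → ℝ^b is an arbitrary function such that for all t: M_p e_p′(t) = −(−1)^{pq+1} D e_q(t) and M_q e_q′(t) = −( (−1)^p Dᵀ e_p(t) + (−1)^{p−1} Tᵀ f_b(t) ). Define the boundary output e_b(t) = (−1)^p T e_q(t) and the Hamiltonian H(t) = ½ ( (−1)^{p(q−1)} e_p(t) · M_p e_p(t) + e_q(t) · M_q e_q(t) ). Then for all t, H′(t) = e_b(t) · f_b(t). -/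

import Mathlib

open Matrix

theorem quad_hasDerivAt {n : ℕ} (M : Matrix (Fin n) (Fin n) ℝ) (hM : M.IsSymm)
    (e : ℝ → Fin n → ℝ) (he : Differentiable ℝ e) (t : ℝ) :
    HasDerivAt (fun s => e s ⬝ᵥ M.mulVec (e s)) (2 * (e t ⬝ᵥ M.mulVec (deriv e t))) t := by
  have h : ∀ i, HasDerivAt (fun s => e s i) (deriv e t i) t :=
    hasDerivAt_pi.1 (he t).hasDerivAt
  have h2 : HasDerivAt (fun s => ∑ i, e s i * ∑ j, M i j * e s j)
      (∑ i, (deriv e t i * (∑ j, M i j * e t j) + e t i * ∑ j, M i j * deriv e t j)) t :=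
    HasDerivAt.fun_sum fun i _ => (h i).mul
      (HasDerivAt.fun_sum fun j _ => (h j).const_mul (M i j))
  have h3 : deriv e t ⬝ᵥ M.mulVec (e t) = e t ⬝ᵥ M.mulVec (deriv e t) := by
    rw [dotProduct_mulVec, ← mulVec_transpose, hM.eq, dotProduct_comm]
  convert h2 using 1
  · rfl
  rw [Finset.sum_add_distrib, two_mul]
  nth_rewrite 1 [← h3]
  rfl

/-- Energy balance `dH/dt = e_b · f_b` for the spatially discretized port-Hamiltonian
system defined with respect to the second simplicial Dirac structure, with boundary
output `e_b = (−1)^p T e_q` and Hamiltonian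
`H = ½ ((−1)^{p(q−1)} e_p · M_p e_p + e_q · M_q e_q)`. -/
theorem energy_balance_second (p q l m b : ℕ) (hp : 1 ≤ p) (hq : 1 ≤ q)
    (D : Matrix (Fin m) (Fin l) ℝ) (T : Matrix (Fin b) (Fin l) ℝ)
    (Mp : Matrix (Fin m) (Fin m) ℝ) (Mq : Matrix (Fin l) (Fin l) ℝ)
    (hMp : Mp.IsSymm) (hMq : Mq.IsSymm)
    (e_p : ℝ → Fin m → ℝ) (e_q : ℝ → Fin l → ℝ) (f_b : ℝ → Fin b → ℝ)
    (hdp : Differentiable ℝ e_p) (hdq : Differentiable ℝ e_q)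
    (hfp : ∀ t, Mp.mulVec (deriv e_p t) = -((-1 : ℝ) ^ (p * q + 1) • D.mulVec (e_q t)))
    (hfq : ∀ t, Mq.mulVec (deriv e_q t)
        = -((-1 : ℝ) ^ p • Dᵀ.mulVec (e_p t)
            + (-1 : ℝ) ^ (p - 1) • Tᵀ.mulVec (f_b t))) :
    ∀ t, deriv (fun s => (1 / 2 : ℝ)
            * ((-1 : ℝ) ^ (p * (q - 1)) * (e_p s ⬝ᵥ Mp.mulVec (e_p s))
              + e_q s ⬝ᵥ Mq.mulVec (e_q s))) t
      = ((-1 : ℝ) ^ p • T.mulVec (e_q t)) ⬝ᵥ f_b t := by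
  intro t
  have H := (((quad_hasDerivAt Mp hMp e_p hdp t).const_mul ((-1 : ℝ) ^ (p * (q - 1)))).add
    (quad_hasDerivAt Mq hMq e_q hdq t)).const_mul (1 / 2 : ℝ)
  refine H.deriv.trans ?_
  rw [hfp, hfq]
  obtain ⟨p, rfl⟩ := Nat.exists_eq_add_of_le' hp
  obtain ⟨q, rfl⟩ := Nat.exists_eq_add_of_le' hq
  have h1 : e_q t ⬝ᵥ Dᵀ.mulVec (e_p t) = e_p t ⬝ᵥ D.mulVec (e_q t) := by
    rw [mulVec_transpose, dotProduct_comm, ← dotProduct_mulVec]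
  have h2 : e_q t ⬝ᵥ Tᵀ.mulVec (f_b t) = T.mulVec (e_q t) ⬝ᵥ f_b t := by
    rw [mulVec_transpose, dotProduct_comm, ← dotProduct_mulVec, dotProduct_comm]
  simp only [dotProduct_neg, dotProduct_add, dotProduct_smul, smul_dotProduct, smul_eq_mul,
    h1, h2, Nat.add_sub_cancel]
  have h3 : (-1 : ℝ) ^ ((p + 1) * q) * (-1 : ℝ) ^ ((p + 1) * (q + 1) + 1) = (-1) ^ p := by
    rw [← pow_add, show (p + 1) * q + ((p + 1) * (q + 1) + 1) = 2 * ((p + 1) * q + 1) + p by ring,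
      pow_add, pow_mul]
    simp
  rw [pow_succ (-1 : ℝ) p]
  linear_combination (-(e_p t ⬝ᵥ D.mulVec (e_q t))) * h3
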